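/- Every strategy profile of a feasible CC-MAR instance whose total cost is minimum among all strategy profiles is a pure Nash equilibrium. In particular, the price of stability of CC-MAR is 1. -/

import Mathlib

/-- A mixed graph: a set `E` of undirected edges (non-diagonal `Sym2`s) and
a set `A` of arcs (ordered pairs of distinct vertices). -/
structure MixedGraph (V : Type*) where
  E : Finset (Sym2 V)
  A : Finset (V × V)
  not_diag : ∀ e ∈ E, ¬ e.IsDiag
  arc_ne : ∀ a ∈ A, a.1 ≠ a.2

variable {V : Type*} [DecidableEq V]

/-- One step of a path: along an undirected edge or along an arc (in its direction). -/
def MixedGraph.Step (G : MixedGraph V) (u v : V) : Prop :=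
  s(u, v) ∈ G.E ∨ (u, v) ∈ G.A

instance (G : MixedGraph V) : DecidableRel G.Step :=
  fun _ _ => inferInstanceAs (Decidable (_ ∨ _))

/-- `G.IsPath s t P`: `P` is a path from `s` to `t` in the mixed graph `G`:
a sequence of pairwise distinct vertices starting at `s`, ending at `t`, each
consecutive step being along an edge or an arc in its direction. -/
def MixedGraph.IsPath (G : MixedGraph V) (s t : V) (P : List V) : Prop :=
  P.Nodup ∧ P.head? = some s ∧ P.getLast? = some t ∧ P.Chain' G.Step

/-- `traverses P u v`: the path `P` moves from `u` directly to `v`. -/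
def traverses (P : List V) (u v : V) : Prop := (u, v) ∈ P.zip P.tail

instance (P : List V) (u v : V) : Decidable (traverses P u v) :=
  inferInstanceAs (Decidable ((u, v) ∈ P.zip P.tail))

/-- 0/1 indicator of `traverses P u v`. -/
def dirInd (P : List V) (u v : V) : ℕ := if traverses P u v then 1 else 0

variable {ι : Type*} [Fintype ι] [DecidableEq ι]

/-- `x_{(u,v)}`: the number of agents whose path traverses the edge `{u,v}` from `u` to `v`. -/
def dirCount (P : ι → List V) (u v : V) : ℕ :=
  (Finset.univ.filter fun i => traverses (P i) u v).card

/-- The total cost `Σ_{e={u,v} ∈ E} w_e · x_{(u,v)} · x_{(v,u)}` of a strategy profile. -/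
def MixedGraph.totalCost (G : MixedGraph V) (w : Sym2 V → ℕ) (P : ι → List V) : ℕ :=
  ∑ e ∈ G.E, Sym2.lift ⟨fun u v => w s(u, v) * (dirCount P u v * dirCount P v u),
    by intro a b; dsimp only; rw [show s(b, a) = s(a, b) from Sym2.eq_swap]; ring⟩ e

/-- The crossing cost of two paths: the sum of `w_e` over edges `e ∈ E` that the
two paths traverse in opposite directions. -/
def MixedGraph.crossCost (G : MixedGraph V) (w : Sym2 V → ℕ) (P Q : List V) : ℕ :=
  ∑ e ∈ G.E, Sym2.lift ⟨fun u v =>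
      w s(u, v) * (dirInd P u v * dirInd Q v u + dirInd P v u * dirInd Q u v),
    by intro a b; dsimp only; rw [show s(b, a) = s(a, b) from Sym2.eq_swap]; ring⟩ e

/-- Number of agents other than `i` traversing from `u` to `v`. -/
def oppCount (P : ι → List V) (i : ι) (u v : V) : ℕ :=
  (Finset.univ.filter fun j => j ≠ i ∧ traverses (P j) u v).card

/-- The individual cost of agent `i`: for each edge `e` traversed by `P i`,
`w_e` times the number of other agents traversing `e` in the opposite direction. -/
def MixedGraph.indivCost (G : MixedGraph V) (w : Sym2 V → ℕ) (P : ι → List V) (i : ι) : ℕ :=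
  ∑ e ∈ G.E, Sym2.lift ⟨fun u v =>
      w s(u, v) * (dirInd (P i) u v * oppCount P i v u + dirInd (P i) v u * oppCount P i u v),
    by intro a b; dsimp only; rw [show s(b, a) = s(a, b) from Sym2.eq_swap]; ring⟩ e

/-- A strategy profile: for each terminal pair `T i = (sᵢ, tᵢ)`, an `sᵢ`–`tᵢ` path. -/
def MixedGraph.IsProfile (G : MixedGraph V) (T : ι → V × V) (P : ι → List V) : Prop :=
  ∀ i, G.IsPath (T i).1 (T i).2 (P i)

/-- A pure Nash equilibrium: no agent can strictly decrease its individual cost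
by unilaterally switching to another path between its terminals. -/
def MixedGraph.IsNash (G : MixedGraph V) (w : Sym2 V → ℕ) (T : ι → V × V)
    (P : ι → List V) : Prop :=
  ∀ i (P' : List V), G.IsPath (T i).1 (T i).2 P' →
    G.indivCost w P i ≤ G.indivCost w (Function.update P i P') i

omit [DecidableEq V] in
theorem not_traverses_swap {P : List V} (hP : P.Nodup) {u v : V} (h : traverses P u v) :
    ¬ traverses P v u := by
  intro h'
  obtain ⟨n, hn, hnuv⟩ := List.mem_iff_getElem.1 h
  obtain ⟨m, hm, hmvu⟩ := List.mem_iff_getElem.1 h'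
  simp only [List.length_zip, List.length_tail, lt_inf_iff] at hn hm
  simp only [List.getElem_zip, List.getElem_tail, Prod.mk.injEq] at hnuv hmvu
  have h₁ := (hP.getElem_inj_iff).1 (hnuv.1.trans hmvu.2.symm)
  have h₂ := (hP.getElem_inj_iff).1 (hnuv.2.trans hmvu.1.symm)
  omega

theorem dirInd_mul_dirInd_swap {P : List V} (hP : P.Nodup) (u v : V) :
    dirInd P u v * dirInd P v u = 0 := by
  by_cases h : traverses P u v
  · simp [dirInd, not_traverses_swap hP h]
  · simp [dirInd, h]

theorem dirCount_eq_dirInd_add_oppCount (P : ι → List V) (i : ι) (u v : V) :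
    dirCount P u v = dirInd (P i) u v + oppCount P i u v := by
  simp only [dirCount, dirInd, oppCount, Finset.card_filter]
  rw [← Finset.add_sum_erase _ _ (Finset.mem_univ i),
    ← Finset.add_sum_erase _ (fun j => if j ≠ i ∧ _ then 1 else 0) (Finset.mem_univ i)]
  simp only [ne_eq, not_true_eq_false, false_and, if_false, zero_add]
  congr 1
  refine Finset.sum_congr rfl fun j hj => ?_
  simp [Finset.ne_of_mem_erase hj]

theorem oppCount_update (P : ι → List V) (i : ι) (P' : List V) (u v : V) :
    oppCount (Function.update P i P') i u v = oppCount P i u v := by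
  unfold oppCount
  congr 1
  refine Finset.filter_congr fun j _ => and_congr_right fun hj => ?_
  rw [Function.update_of_ne hj]

/-- The part of the total cost of a profile caused by the agents other than `i`. -/
def MixedGraph.restCost (G : MixedGraph V) (w : Sym2 V → ℕ) (P : ι → List V) (i : ι) : ℕ :=
  ∑ e ∈ G.E, Sym2.lift ⟨fun u v => w s(u, v) * (oppCount P i u v * oppCount P i v u),
    by intro a b; dsimp only; rw [show s(b, a) = s(a, b) from Sym2.eq_swap]; ring⟩ e

theorem MixedGraph.totalCost_eq_indivCost_add_restCost (G : MixedGraph V) (w : Sym2 V → ℕ)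
    (P : ι → List V) (i : ι) (hP : (P i).Nodup) :
    G.totalCost w P = G.indivCost w P i + G.restCost w P i := by
  unfold MixedGraph.totalCost MixedGraph.indivCost MixedGraph.restCost
  rw [← Finset.sum_add_distrib]
  refine Finset.sum_congr rfl fun e _ => ?_
  induction e using Sym2.ind with
  | _ u v =>
    simp only [Sym2.lift_mk, dirCount_eq_dirInd_add_oppCount P i]
    linear_combination w s(u, v) * dirInd_mul_dirInd_swap hP u v

theorem MixedGraph.restCost_update (G : MixedGraph V) (w : Sym2 V → ℕ) (P : ι → List V) (i : ι)
    (P' : List V) : G.restCost w (Function.update P i P') i = G.restCost w P i := by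
  simp only [MixedGraph.restCost, oppCount_update]

/-- every minimum-cost strategy profile of a feasible CC-MAR instance
is a pure Nash equilibrium (hence the price of stability is 1). -/
theorem stmt2 {k : ℕ} (G : MixedGraph V) (w : Sym2 V → ℕ) (hw : ∀ e ∈ G.E, 0 < w e)
    (T : Fin k → V × V) (hT : ∀ i, (T i).1 ≠ (T i).2)
    (hfeas : ∀ i, ∃ Q : List V, G.IsPath (T i).1 (T i).2 Q)
    (P : Fin k → List V) (hP : G.IsProfile T P)
    (hmin : ∀ Q : Fin k → List V, G.IsProfile T Q → G.totalCost w P ≤ G.totalCost w Q) :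
    G.IsNash w T P := by
  intro i P' hP'
  have hQ : G.IsProfile T (Function.update P i P') := by
    intro j
    obtain rfl | hj := eq_or_ne j i
    · simpa using hP'
    · simpa [hj] using hP j
  have h := hmin _ hQ
  rw [G.totalCost_eq_indivCost_add_restCost w P i (hP i).1,
    G.totalCost_eq_indivCost_add_restCost w _ i (hQ i).1, G.restCost_update] at h
  exact Nat.le_of_add_le_add_right h
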